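/- Fix β ∈ (0,2) and let H(r) = (1/4)(1 − coth r) · [ (β−1)²(1 − 3e^{2r}) − e^{6r}(1 − 3e^{−2r}) ] / (e^{4r} − (β−1)²) for r > 0 (the Higgs-field profile of the Einstein-family monopole). Then H has exactly one zero r₀ in (0,∞); moreover r₀ ≤ (1/2)log 3, with equality r₀ = (1/2)log 3 if and only if β = 1. (Thus the Higgs field of the Einstein-family monopole vanishes on a single 2-sphere of radius r₀ ∈ (0, (1/2)log 3].) -/

import Mathlib

noncomputable section

/-- The Higgs profile of the Einstein-family monopole:
`H(r) = (1/4)(1 − coth r)[(β−1)²(1 − 3e^{2r}) − e^{6r}(1 − 3e^{−2r})]/(e^{4r} − (β−1)²)`. -/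
def Hfun (β r : ℝ) : ℝ :=
  (1 / 4) * (1 - Real.cosh r / Real.sinh r)
    * (((β - 1) ^ 2 * (1 - 3 * Real.exp (2 * r))
        - Real.exp (6 * r) * (1 - 3 * Real.exp (-(2 * r))))
      / (Real.exp (4 * r) - (β - 1) ^ 2))

/-- For `r > 0`, the profile vanishes exactly when `x = e^{2r}` is a root of a cubic. -/
theorem Hfun_eq_zero_iff {β r : ℝ} (hβ : (β - 1) ^ 2 < 1) (hr : 0 < r) :
    Hfun β r = 0 ↔
      (β - 1) ^ 2 * (1 - 3 * Real.exp (2 * r))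
        - Real.exp (2 * r) ^ 2 * (Real.exp (2 * r) - 3) = 0 := by
  have hs : 0 < Real.sinh r := Real.sinh_pos_iff.2 hr
  have hc : 1 - Real.cosh r / Real.sinh r ≠ 0 :=
    (sub_neg.2 ((one_lt_div hs).2 (Real.sinh_lt_cosh r))).ne
  have hd : Real.exp (4 * r) - (β - 1) ^ 2 ≠ 0 := by
    have : 1 < Real.exp (4 * r) := Real.one_lt_exp_iff.2 (by linarith)
    exact (sub_pos.2 (hβ.trans this)).ne'
  have hn : Real.exp (6 * r) * (1 - 3 * Real.exp (-(2 * r)))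
      = Real.exp (2 * r) ^ 2 * (Real.exp (2 * r) - 3) := by
    have h6 : Real.exp (6 * r) = Real.exp (2 * r) ^ 3 := by
      rw [← Real.exp_nat_mul]
      congr 1
      push_cast
      ring
    rw [h6, Real.exp_neg]
    field_simp
  rw [Hfun, hn, mul_eq_zero, div_eq_zero_iff]
  simp [hc, hd]

/-- The cubic has at most one root in `(1, ∞)`. -/
theorem cubic_root_unique {b x y : ℝ} (hx : 1 < x) (hy : 1 < y)
    (hbx : b * (1 - 3 * x) - x ^ 2 * (x - 3) = 0)
    (hby : b * (1 - 3 * y) - y ^ 2 * (y - 3) = 0) : x = y := by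
  obtain ⟨s, rfl⟩ : ∃ s, x = 1 + s := ⟨x - 1, by ring⟩
  obtain ⟨t, rfl⟩ : ∃ t, y = 1 + t := ⟨y - 1, by ring⟩
  have hs : 0 < s := by linarith
  have ht : 0 < t := by linarith
  have h : (s - t) * (2 * (s ^ 2 + s * t + t ^ 2) + 3 * s * t * (s + t)) = 0 := by
    linear_combination (-(2 + 3 * t)) * hbx + (2 + 3 * s) * hby
  have hp : 0 < 2 * (s ^ 2 + s * t + t ^ 2) + 3 * s * t * (s + t) := by positivity
  have := (mul_eq_zero.1 h).resolve_right hp.ne'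
  linarith

/-- For `b ∈ [0, 1)` the cubic has a root in `(1, 3]`. -/
theorem exists_cubic_root {b : ℝ} (hb₀ : 0 ≤ b) (hb₁ : b < 1) :
    ∃ x : ℝ, 1 < x ∧ x ≤ 3 ∧ b * (1 - 3 * x) - x ^ 2 * (x - 3) = 0 := by
  have hcont : ContinuousOn (fun x : ℝ => b * (1 - 3 * x) - x ^ 2 * (x - 3)) (Set.Icc 1 3) := by
    fun_prop
  obtain ⟨x, hx, hfx⟩ := intermediate_value_Icc' (by norm_num) hcont
    (show (0 : ℝ) ∈ Set.Icc _ _ from ⟨by linarith, by linarith⟩)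
  refine ⟨x, lt_of_le_of_ne hx.1 ?_, hx.2, hfx⟩
  rintro rfl
  dsimp only at hfx
  linarith

/-- For `β ∈ (0,2)`, the Higgs profile `H` of the Einstein-family monopole has exactly
one zero `r₀` in `(0,∞)`; moreover `r₀ ≤ (1/2)log 3`, with equality if and only if
`β = 1`. -/
theorem einstein_family_higgs_zero (β : ℝ) (hβ : β ∈ Set.Ioo (0 : ℝ) 2) :
    ∃ r₀ : ℝ, 0 < r₀ ∧ Hfun β r₀ = 0 ∧
      (∀ r : ℝ, 0 < r → Hfun β r = 0 → r = r₀) ∧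
      r₀ ≤ (1 / 2) * Real.log 3 ∧
      (r₀ = (1 / 2) * Real.log 3 ↔ β = 1) := by
  have hb : (β - 1) ^ 2 < 1 := by nlinarith [mul_pos hβ.1 (sub_pos.2 hβ.2)]
  obtain ⟨x, hx₁, hx₃, hx⟩ := exists_cubic_root (sq_nonneg (β - 1)) hb
  have hx₀ : 0 < x := by linarith
  have hr : 0 < 1 / 2 * Real.log x := by
    have := Real.log_pos hx₁
    positivity
  have hexp : Real.exp (2 * (1 / 2 * Real.log x)) = x := by
    rw [← mul_assoc, mul_one_div_cancel two_ne_zero, one_mul, Real.exp_log hx₀]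
  refine ⟨1 / 2 * Real.log x, hr, ?_, fun r hr' h => ?_, ?_, fun h => ?_, fun h => ?_⟩
  · rw [Hfun_eq_zero_iff hb hr, hexp]
    exact hx
  · rw [Hfun_eq_zero_iff hb hr'] at h
    have h2 : 1 < Real.exp (2 * r) := Real.one_lt_exp_iff.2 (by linarith)
    rw [← cubic_root_unique h2 hx₁ h hx, Real.log_exp]
    ring
  · have := Real.log_le_log hx₀ hx₃
    linarith
  · have hx3 : x = 3 :=
      Real.log_injOn_pos hx₀ (show (0 : ℝ) < 3 by norm_num) (by linarith)
    subst hx3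
    have : (β - 1) ^ 2 = 0 := by linarith
    exact sub_eq_zero.1 (pow_eq_zero_iff two_ne_zero |>.1 this)
  · subst h
    rw [cubic_root_unique hx₁ (show (1 : ℝ) < 3 by norm_num) hx (by norm_num)]
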